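/- Under the standing stochastic setup, let K ≥ 1, let c_b > 0 and c_p ∈ (0,1], suppose N_k = ⌈c_b K⌉ for all k ∈ {0, …, K−1}, suppose the sampled Armijo condition holds almost surely at every iteration k ∈ {0, …, K−1}, and suppose that almost surely the number of indices k ∈ {0, …, K−1} with t_k ≠ t_{k−1} (t_{−1} ≜ s) is at most (1/c_p + 1)⌈[log_{1/β}(sL/(2(1−α)))]_+ + 2⌉. Then (1/K) Σ_{k=0}^{K−1} E[‖G_s(x_k)‖²] ≤ 2(φ(x_0) − φ_inf)/(α c K) + (1/L + 6 L s² + 2 α c) σ²/(α c c_b K) + 6 L (s − c)² (L_r + 3 B_g)² ⌈[log_{1/β}(sL/(2(1−α)))]_+ + 2⌉ (c_p + 1)/(α c c_p K), where [u]_+ ≜ max{u, 0}. -/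

import Mathlib

open MeasureTheory Filter
open scoped RealInnerProductSpace

section ProximalGeometry

variable {E : Type*} [NormedAddCommGroup E] [InnerProductSpace ℝ E]

/-- The variational characterisation of `p` as the proximal point of `z` for `t • r` over `S`. -/
def IsProxPoint (S : Set E) (r : E → ℝ) (t : ℝ) (z p : E) : Prop :=
  p ∈ S ∧ ∀ y ∈ S, t * (r p - r y) + ⟪z - p, y - p⟫ ≤ 0

lemma isProxPoint_of_isMin {S : Set E} {r : E → ℝ} (hr : ConvexOn ℝ S r) {t : ℝ} (ht : 0 < t)
    {z p : E} (hp : p ∈ S)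
    (hmin : ∀ y ∈ S, r p + ‖p - z‖ ^ 2 / (2 * t) ≤ r y + ‖y - z‖ ^ 2 / (2 * t)) :
    IsProxPoint S r t z p := by
  refine ⟨hp, fun y hy => ?_⟩
  have key : ∀ l ∈ Set.Ioc (0 : ℝ) 1,
      t * (r p - r y) + ⟪z - p, y - p⟫ ≤ l * (‖y - p‖ ^ 2 / 2) := by
    rintro l ⟨hl0, hl1⟩
    have hmem : (1 - l) • p + l • y ∈ S := hr.1 hp hy (by linarith) hl0.le (by ring)
    have h1 := hmin _ hmem
    have h2 := hr.2 hp hy (by linarith : 0 ≤ 1 - l) hl0.le (by ring)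
    have h3 : ‖(1 - l) • p + l • y - z‖ ^ 2
        = ‖p - z‖ ^ 2 - 2 * l * ⟪z - p, y - p⟫ + l ^ 2 * ‖y - p‖ ^ 2 := by
      have : (1 - l) • p + l • y - z = l • (y - p) - (z - p) := by module
      rw [this, norm_sub_sq_real, norm_smul, inner_smul_left, real_inner_comm,
        norm_sub_rev z p, mul_pow, Real.norm_eq_abs, sq_abs]
      simp only [conj_trivial]
      ring
    rw [h3] at h1
    simp only [smul_eq_mul] at h2
    have h4 : l * (r p - r y)
        ≤ (l ^ 2 * ‖y - p‖ ^ 2 - 2 * l * ⟪z - p, y - p⟫) / (2 * t) := by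
      have : (‖p - z‖ ^ 2 - 2 * l * ⟪z - p, y - p⟫ + l ^ 2 * ‖y - p‖ ^ 2) / (2 * t)
          = ‖p - z‖ ^ 2 / (2 * t)
            + (l ^ 2 * ‖y - p‖ ^ 2 - 2 * l * ⟪z - p, y - p⟫) / (2 * t) := by ring
      rw [this] at h1
      linarith
    rw [le_div_iff₀ (by positivity)] at h4
    refine le_of_mul_le_mul_left ?_ hl0
    nlinarith
  refine le_of_forall_pos_le_add fun ε hε => ?_
  have hA : 0 ≤ ‖y - p‖ ^ 2 / 2 := by positivity
  refine (key (min 1 (ε / (‖y - p‖ ^ 2 / 2 + 1)))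
    ⟨lt_min one_pos (by positivity), min_le_left _ _⟩).trans ?_
  rw [zero_add]
  calc _ ≤ ε / (‖y - p‖ ^ 2 / 2 + 1) * (‖y - p‖ ^ 2 / 2 + 1) := by
        gcongr
        · exact min_le_right _ _
        · linarith
    _ = ε := by field_simp

lemma IsProxPoint.norm_sub_le {S : Set E} {r : E → ℝ} {t : ℝ} {z z' p p' : E}
    (h : IsProxPoint S r t z p) (h' : IsProxPoint S r t z' p') : ‖p - p'‖ ≤ ‖z - z'‖ := by
  have h1 := h.2 p' h'.1
  have h2 := h'.2 p h.1
  have h3 : ⟪z - p, p' - p⟫ + ⟪z' - p', p - p'⟫ = ‖p - p'‖ ^ 2 - ⟪z - z', p - p'⟫ := by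
    rw [← real_inner_self_eq_norm_sq, ← neg_sub p p', inner_neg_right]
    simp only [inner_sub_left]
    ring
  have h4 := real_inner_le_norm (z - z') (p - p')
  by_contra! hlt
  nlinarith [norm_nonneg (z - z')]

/-- Monotonicity of the subdifferential between two proximal gradient steps from `x`. -/
lemma IsProxPoint.step_monotone {S : Set E} {r : E → ℝ} {t t' : ℝ} (ht : 0 < t) (ht' : 0 < t')
    {x v p p' : E} (h : IsProxPoint S r t (x - t • v) p)
    (h' : IsProxPoint S r t' (x - t' • v) p') :
    t' * ⟪x - p, p' - p⟫ ≤ t * ⟪x - p', p' - p⟫ := by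
  have h1 := mul_le_mul_of_nonneg_left (h.2 p' h'.1) ht'.le
  have h2 := mul_le_mul_of_nonneg_left (h'.2 p h.1) ht.le
  have e1 : ⟪x - t • v - p, p' - p⟫ = ⟪x - p, p' - p⟫ - t * ⟪v, p' - p⟫ := by
    rw [← real_inner_smul_left, ← inner_sub_left]; congr 1; abel
  have e2 : ⟪x - t' • v - p', p - p'⟫ = -⟪x - p', p' - p⟫ + t' * ⟪v, p' - p⟫ := by
    rw [← neg_sub p' p, inner_neg_right, ← real_inner_smul_left]
    simp only [inner_sub_left]
    ring
  rw [e1] at h1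
  rw [e2] at h2
  nlinarith

lemma IsProxPoint.step_lipschitz {S : Set E} {r : E → ℝ} {t t' : ℝ} (ht : 0 < t) (ht' : 0 < t')
    {x v p p' : E} (h : IsProxPoint S r t (x - t • v) p)
    (h' : IsProxPoint S r t' (x - t' • v) p') :
    t' * ‖p - p'‖ ≤ |t - t'| * ‖x - p'‖ := by
  have h1 := h.step_monotone ht ht' h'
  have h2 : ⟪x - p, p' - p⟫ = ⟪x - p', p' - p⟫ + ‖p - p'‖ ^ 2 := by
    rw [norm_sub_rev, ← real_inner_self_eq_norm_sq, ← inner_add_left]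
    congr 1; abel
  have h3 : (t - t') * ⟪x - p', p' - p⟫ ≤ |t - t'| * (‖x - p'‖ * ‖p - p'‖) := by
    calc _ ≤ |(t - t') * ⟪x - p', p' - p⟫| := le_abs_self _
      _ ≤ _ := by
        rw [abs_mul, norm_sub_rev p p']
        gcongr
        exact abs_real_inner_le_norm _ _
  rcases (norm_nonneg (p - p')).eq_or_lt with h0 | h0
  · rw [← h0]; simp only [mul_zero]; positivity
  · refine le_of_mul_le_mul_right ?_ h0
    rw [h2] at h1
    nlinarith

lemma IsProxPoint.norm_step_le {S : Set E} {r : E → ℝ} {Lr : ℝ}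
    (hrlip : ∀ z ∈ S, ∀ w ∈ S, |r z - r w| ≤ Lr * ‖z - w‖) {t : ℝ} (ht : 0 < t)
    {x v p : E} (hx : x ∈ S) (h : IsProxPoint S r t (x - t • v) p) {B : ℝ} (hB : ‖v‖ ≤ B)
    (hLr : 0 ≤ Lr) :
    ‖x - p‖ ≤ t * (Lr + B) := by
  have h1 := h.2 x hx
  have e1 : ⟪x - t • v - p, x - p⟫ = ‖x - p‖ ^ 2 - t * ⟪v, x - p⟫ := by
    rw [← real_inner_smul_left, ← real_inner_self_eq_norm_sq, ← inner_sub_left]; congr 1; abel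
  have h2 : t * (r x - r p) ≤ t * (Lr * ‖x - p‖) :=
    mul_le_mul_of_nonneg_left ((le_abs_self _).trans (hrlip x hx p h.1)) ht.le
  have h3 : t * ⟪v, x - p⟫ ≤ t * (B * ‖x - p‖) :=
    mul_le_mul_of_nonneg_left ((real_inner_le_norm _ _).trans (by gcongr)) ht.le
  rw [e1] at h1
  rcases (norm_nonneg (x - p)).eq_or_lt with h0 | h0
  · rw [← h0]
    have : 0 ≤ B := (norm_nonneg v).trans hB
    positivity
  · refine le_of_mul_le_mul_right ?_ h0
    nlinarith

lemma IsProxPoint.norm_step_antitone {S : Set E} {r : E → ℝ} {t s : ℝ} (ht : 0 < t) (hts : t ≤ s)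
    {x v p q : E} (h : IsProxPoint S r t (x - t • v) p)
    (h' : IsProxPoint S r s (x - s • v) q) :
    ‖x - q‖ / s ≤ ‖x - p‖ / t := by
  have hs : 0 < s := ht.trans_le hts
  have h1 := h.step_monotone ht hs h'
  have e : q - p = (x - p) - (x - q) := by abel
  rw [e, inner_sub_right _ (x - p), inner_sub_right _ (x - p),
    real_inner_self_eq_norm_sq, real_inner_self_eq_norm_sq, real_inner_comm (x - p) (x - q)] at h1
  have h2 := real_inner_le_norm (x - p) (x - q)
  rw [div_le_div_iff₀ hs ht]
  by_contra! hlt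
  have ha := norm_nonneg (x - p)
  have hb := norm_nonneg (x - q)
  have h3 : s * ‖x - p‖ ^ 2 + t * ‖x - q‖ ^ 2 ≤ (s + t) * (‖x - p‖ * ‖x - q‖) := by
    nlinarith
  have hab : ‖x - p‖ < ‖x - q‖ := by nlinarith
  nlinarith [mul_pos (sub_pos.2 hlt) (sub_pos.2 hab)]

lemma descent_of_lipschitz_gradient [CompleteSpace E] {S : Set E} (hS : Convex ℝ S)
    {h : E → ℝ} {G : E → E} (hG : ∀ z ∈ S, HasGradientAt h (G z) z) {M : ℝ}
    (hM : ∀ z ∈ S, ∀ w ∈ S, ‖G z - G w‖ ≤ M * ‖z - w‖) {y w : E} (hy : y ∈ S) (hw : w ∈ S) :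
    h w - h y ≤ ⟪G y, w - y⟫ + M / 2 * ‖w - y‖ ^ 2 := by
  have hmem : ∀ τ ∈ Set.Icc (0 : ℝ) 1, y + τ • (w - y) ∈ S := fun τ hτ =>
    hS.add_smul_sub_mem hy hw hτ
  have hderiv : ∀ τ ∈ Set.Icc (0 : ℝ) 1, HasDerivAt
      (fun τ : ℝ => h (y + τ • (w - y)) - τ * ⟪G y, w - y⟫ - M / 2 * ‖w - y‖ ^ 2 * τ ^ 2)
      (⟪G (y + τ • (w - y)), w - y⟫ - ⟪G y, w - y⟫ - M / 2 * ‖w - y‖ ^ 2 * (2 * τ)) τ := by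
    intro τ hτ
    have h1 : HasDerivAt (fun τ : ℝ => y + τ • (w - y)) (w - y) τ := by
      simpa using ((hasDerivAt_id τ).smul_const (w - y)).const_add y
    have h2 := ((hG _ (hmem τ hτ)).hasFDerivAt).comp_hasDerivAt τ h1
    have h3 := (hasDerivAt_id τ).mul_const ⟪G y, w - y⟫
    have h4 := (hasDerivAt_pow 2 τ).const_mul (M / 2 * ‖w - y‖ ^ 2)
    refine ((h2.sub h3).sub h4).congr_deriv ?_
    simp
  have hanti := antitoneOn_of_deriv_nonpos (convex_Icc (0 : ℝ) 1)
    (fun τ hτ => (hderiv τ hτ).continuousAt.continuousWithinAt)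
    (fun τ hτ => (hderiv τ (interior_subset hτ)).differentiableAt.differentiableWithinAt)
    (fun τ hτ => by
      have hτ' := interior_subset hτ
      rw [(hderiv τ hτ').deriv, ← inner_sub_left]
      have h1 := real_inner_le_norm (G (y + τ • (w - y)) - G y) (w - y)
      have h2 := hM _ (hmem τ hτ') y hy
      rw [add_sub_cancel_left, norm_smul, Real.norm_of_nonneg hτ'.1] at h2
      have h3 := mul_le_mul_of_nonneg_right h2 (norm_nonneg (w - y))
      nlinarith)
  have := hanti (Set.left_mem_Icc.2 zero_le_one) (Set.right_mem_Icc.2 zero_le_one) zero_le_one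
  simp only [one_smul, zero_smul, add_zero, add_sub_cancel] at this
  linarith

/-- The difference of two functions with `L`-Lipschitz gradients varies between `y` and `w` by at
most the gradient error at `y` and the squared distance. -/
lemma sub_gradient_error_bound [CompleteSpace E] {S : Set E} (hS : Convex ℝ S)
    {f F : E → ℝ} {g G : E → E} (hf : ∀ z ∈ S, HasGradientAt f (g z) z)
    (hF : ∀ z ∈ S, HasGradientAt F (G z) z) {L : ℝ} (hL : 0 < L)
    (hg : ∀ z ∈ S, ∀ w ∈ S, ‖g z - g w‖ ≤ L * ‖z - w‖)
    (hG : ∀ z ∈ S, ∀ w ∈ S, ‖G z - G w‖ ≤ L * ‖z - w‖) {y w : E} (hy : y ∈ S) (hw : w ∈ S) :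
    (f w - F w) - (f y - F y)
      ≤ 1 / (2 * L) * ‖G y - g y‖ ^ 2 + 3 * L / 2 * ‖w - y‖ ^ 2 := by
  have h1 := descent_of_lipschitz_gradient hS (h := fun z => f z - F z) (G := fun z => g z - G z)
    (M := 2 * L) (fun z hz => by
      rw [hasGradientAt_iff_hasFDerivAt, map_sub]
      exact (hf z hz).hasFDerivAt.sub (hF z hz).hasFDerivAt) (fun z hz w hw => by
      have e : g z - G z - (g w - G w) = (g z - g w) - (G z - G w) := by abel
      rw [e]
      have := norm_sub_le (g z - g w) (G z - G w)
      linarith [hg z hz w hw, hG z hz w hw]) hy hw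
  have h2 := real_inner_le_norm (g y - G y) (w - y)
  rw [norm_sub_rev (g y)] at h2
  have h3 : ‖G y - g y‖ * ‖w - y‖ ≤ 1 / (2 * L) * ‖G y - g y‖ ^ 2 + L / 2 * ‖w - y‖ ^ 2 := by
    have : 1 / (2 * L) * ‖G y - g y‖ ^ 2 + L / 2 * ‖w - y‖ ^ 2 - ‖G y - g y‖ * ‖w - y‖
        = 1 / (2 * L) * (‖G y - g y‖ - L * ‖w - y‖) ^ 2 := by field_simp; ring
    have h4 : 0 ≤ 1 / (2 * L) * (‖G y - g y‖ - L * ‖w - y‖) ^ 2 := by positivity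
    linarith
  linarith

/-- One-step progress of the sampled Armijo condition from `x` to `p` measured by the exact
proximal gradient mapping at `x`; `y` is a reference proximal point with stepsize `t'`. -/
lemma armijo_step_bound [CompleteSpace E] {S : Set E} {r : E → ℝ} (hr : ConvexOn ℝ S r)
    {Lr : ℝ} (hLr : 0 ≤ Lr) (hrlip : ∀ z ∈ S, ∀ w ∈ S, |r z - r w| ≤ Lr * ‖z - w‖)
    {prox : ℝ → E → E} (hprox : ∀ t : ℝ, 0 < t → ∀ z, IsProxPoint S r t z (prox t z))
    {f F : E → ℝ} {g G : E → E} (hf : ∀ z ∈ S, HasGradientAt f (g z) z)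
    (hF : ∀ z ∈ S, HasGradientAt F (G z) z) {L : ℝ} (hL : 0 < L)
    (hg : ∀ z ∈ S, ∀ w ∈ S, ‖g z - g w‖ ≤ L * ‖z - w‖)
    (hG : ∀ z ∈ S, ∀ w ∈ S, ‖G z - G w‖ ≤ L * ‖z - w‖)
    {Bg : ℝ} (hBg : ∀ z ∈ S, ‖g z‖ ≤ Bg) {α c s t t' : ℝ} (hα : 0 < α) (hc : 0 < c)
    (ht : t ∈ Set.Icc c s) (ht' : t' ∈ Set.Icc c s) {x p y : E} (hx : x ∈ S)
    (hp : p = prox t (x - t • G x)) (hy : y = prox t' (x - t' • g x))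
    (harmijo : F p + r p ≤ F x + r x - (α / t) * ‖x - p‖ ^ 2) :
    α * c / 2 * ‖(1 / s) • (x - prox s (x - s • g x))‖ ^ 2
      ≤ (f x + r x) - (f p + r p) + (F x - f x) - (F y - f y)
        + 1 / (2 * L) * ‖G y - g y‖ ^ 2 + (3 * L * s ^ 2 + α * c) * ‖G x - g x‖ ^ 2
        + 3 * L * (s - c) ^ 2 * (Lr + 3 * Bg) ^ 2 * (if t = t' then 0 else 1) := by
  have ht0 : 0 < t := hc.trans_le ht.1
  have ht0' : 0 < t' := hc.trans_le ht'.1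
  have hs : 0 < s := ht0.trans_le ht.2
  have hB : 0 ≤ Bg := (norm_nonneg _).trans (hBg x hx)
  have hP := hprox t ht0 (x - t • G x)
  rw [← hp] at hP
  have hY := hprox t' ht0' (x - t' • g x)
  rw [← hy] at hY
  have hM := hprox t ht0 (x - t • g x)
  have hQ := hprox s hs (x - s • g x)
  have hQ' := hprox s hs (x - s • G x)
  have shift : ∀ a : ℝ, 0 < a → ‖x - a • G x - (x - a • g x)‖ = a * ‖G x - g x‖ := fun a ha => by
    have e : x - a • G x - (x - a • g x) = -(a • (G x - g x)) := by module
    rw [e, norm_neg, norm_smul, Real.norm_of_nonneg ha.le]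
  set e := ‖G x - g x‖ with he
  have he0 : 0 ≤ e := norm_nonneg _
  have hstat : ‖(1 / s) • (x - prox s (x - s • g x))‖ ≤ ‖x - p‖ / t + e := by
    have h1 := hQ'.norm_sub_le hQ
    rw [shift s hs] at h1
    have h2 := hP.norm_step_antitone ht0 ht.2 hQ'
    have h3 := norm_sub_le_norm_sub_add_norm_sub x (prox s (x - s • G x)) (prox s (x - s • g x))
    rw [norm_smul, Real.norm_of_nonneg (by positivity), one_div_mul_eq_div]
    calc _ ≤ (‖x - prox s (x - s • G x)‖ + s * e) / s := by gcongr; linarith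
      _ = ‖x - prox s (x - s • G x)‖ / s + e := by field_simp
      _ ≤ _ := by gcongr
  have hstat2 : α * c / 2 * ‖(1 / s) • (x - prox s (x - s • g x))‖ ^ 2
      ≤ (α / t) * ‖x - p‖ ^ 2 + α * c * e ^ 2 := by
    calc _ ≤ α * c / 2 * (‖x - p‖ / t + e) ^ 2 := by gcongr
      _ ≤ α * c * (‖x - p‖ / t) ^ 2 + α * c * e ^ 2 := by
        nlinarith [mul_nonneg (mul_pos hα hc).le (sq_nonneg (‖x - p‖ / t - e))]
      _ ≤ α * t * (‖x - p‖ / t) ^ 2 + α * c * e ^ 2 := by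
        have := ht.1
        gcongr
      _ = _ := by field_simp
  have hdist : ‖p - y‖ ^ 2 ≤ 2 * s ^ 2 * e ^ 2
      + 2 * ((s - c) ^ 2 * (Lr + 3 * Bg) ^ 2 * (if t = t' then 0 else 1)) := by
    have h1 := hP.norm_sub_le hM
    rw [shift t ht0] at h1
    have h1' : ‖p - prox t (x - t • g x)‖ ≤ s * e :=
      h1.trans (mul_le_mul_of_nonneg_right ht.2 he0)
    have h2 := hM.step_lipschitz ht0 ht0' hY
    have h3 := hY.norm_step_le hrlip ht0' hx (hBg x hx) hLr
    have h4 : ‖prox t (x - t • g x) - y‖ ≤ |t - t'| * (Lr + 3 * Bg) := by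
      refine le_of_mul_le_mul_left ?_ ht0'
      calc _ ≤ |t - t'| * ‖x - y‖ := h2
        _ ≤ |t - t'| * (t' * (Lr + 3 * Bg)) := by
          gcongr
          exact h3.trans (by gcongr; linarith)
        _ = _ := by ring
    have h5 : ‖p - y‖ ≤ s * e + |t - t'| * (Lr + 3 * Bg) :=
      (norm_sub_le_norm_sub_add_norm_sub _ _ _).trans (add_le_add h1' h4)
    have h6 : |t - t'| ^ 2 ≤ (s - c) ^ 2 * (if t = t' then 0 else 1) := by
      split_ifs with h
      · simp [h]
      · rw [mul_one]
        gcongr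
        exact abs_le.2 ⟨by linarith [ht.1, ht'.2], by linarith [ht.2, ht'.1]⟩
    calc _ ≤ (s * e + |t - t'| * (Lr + 3 * Bg)) ^ 2 := by gcongr
      _ ≤ 2 * s ^ 2 * e ^ 2 + 2 * (|t - t'| ^ 2 * (Lr + 3 * Bg) ^ 2) := by
        nlinarith [sq_nonneg (s * e - |t - t'| * (Lr + 3 * Bg))]
      _ ≤ 2 * s ^ 2 * e ^ 2
          + 2 * ((s - c) ^ 2 * (if t = t' then 0 else 1) * (Lr + 3 * Bg) ^ 2) := by gcongr
      _ = _ := by ring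
  have herr := sub_gradient_error_bound hr.1 hf hF hL hg hG hY.1 hP.1
  have hdist' := mul_le_mul_of_nonneg_left hdist (by positivity : 0 ≤ 3 * L / 2)
  linarith

/-- Proximal gradient steps depend jointly continuously on the stepsize and the base point. -/
lemma continuous_prox_step {S : Set E} {r : E → ℝ}
    {prox : ℝ → E → E} (hprox : ∀ t : ℝ, 0 < t → ∀ z, IsProxPoint S r t z (prox t z))
    {g : E → E} {L : ℝ} (hg : ∀ z ∈ S, ∀ w ∈ S, ‖g z - g w‖ ≤ L * ‖z - w‖) :
    Continuous fun q : Set.Ioi (0 : ℝ) × S =>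
      prox q.1 ((q.2 : E) - (q.1 : ℝ) • g q.2) := by
  have hgcont : Continuous fun z : S => g z := by
    have hlip : LipschitzWith L.toNNReal fun z : S => g z :=
      LipschitzWith.of_dist_le_mul fun z w => by
        rw [dist_eq_norm, Subtype.dist_eq, dist_eq_norm]
        refine (hg z z.2 w w.2).trans ?_
        gcongr
        exact Real.le_coe_toNNReal L
    exact hlip.continuous
  rw [continuous_iff_continuousAt]
  rintro ⟨t₀, z₀⟩
  set p₀ := prox t₀ ((z₀ : E) - (t₀ : ℝ) • g z₀) with hp₀
  have ht₀ : (0 : ℝ) < t₀ := t₀.2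
  rw [ContinuousAt, tendsto_iff_norm_sub_tendsto_zero]
  have hbound : ∀ q : Set.Ioi (0 : ℝ) × S,
      ‖prox q.1 ((q.2 : E) - (q.1 : ℝ) • g q.2) - p₀‖
        ≤ ‖((q.2 : E) - (q.1 : ℝ) • g q.2) - ((z₀ : E) - (q.1 : ℝ) • g z₀)‖
          + |(q.1 : ℝ) - t₀| * ‖(z₀ : E) - p₀‖ / t₀ := by
    rintro ⟨t, z⟩
    have h1 := (hprox t t.2 ((z : E) - (t : ℝ) • g z)).norm_sub_le
      (hprox t t.2 ((z₀ : E) - (t : ℝ) • g z₀))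
    have h2 := (hprox t t.2 ((z₀ : E) - (t : ℝ) • g z₀)).step_lipschitz t.2 ht₀
      (hprox t₀ ht₀ ((z₀ : E) - (t₀ : ℝ) • g z₀))
    rw [mul_comm, ← le_div_iff₀ ht₀] at h2
    exact (norm_sub_le_norm_sub_add_norm_sub _ _ _).trans (add_le_add h1 h2)
  refine squeeze_zero (fun _ => norm_nonneg _) hbound ?_
  have hcont : Continuous fun q : Set.Ioi (0 : ℝ) × S =>
      ‖((q.2 : E) - (q.1 : ℝ) • g q.2) - ((z₀ : E) - (q.1 : ℝ) • g z₀)‖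
        + |(q.1 : ℝ) - t₀| * ‖(z₀ : E) - p₀‖ / t₀ := by
    have h1 : Continuous fun q : Set.Ioi (0 : ℝ) × S => g q.2 := hgcont.comp continuous_snd
    have h2 : Continuous fun q : Set.Ioi (0 : ℝ) × S => (q.2 : E) :=
      continuous_subtype_val.comp continuous_snd
    have h3 : Continuous fun q : Set.Ioi (0 : ℝ) × S => (q.1 : ℝ) :=
      continuous_subtype_val.comp continuous_fst
    exact ((h2.sub (h3.smul h1)).sub (continuous_const.sub (h3.smul continuous_const))).norm.add
      (((h3.sub continuous_const).abs.mul continuous_const).div_const _)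
  simpa using hcont.tendsto (t₀, z₀)

end ProximalGeometry

section Oracle

variable {Ω : Type*} {m0 : MeasurableSpace Ω} {μ : Measure Ω} [IsProbabilityMeasure μ]

lemma integral_sub_eq_zero_of_condExp_eq {m : MeasurableSpace Ω} (hm : m ≤ m0) {X Y : Ω → ℝ}
    (hX : Integrable X μ) (hXY : μ[X|m] =ᵐ[μ] Y) :
    Integrable (fun ω => X ω - Y ω) μ ∧ ∫ ω, (X ω - Y ω) ∂μ = 0 := by
  have hY : Integrable Y μ := integrable_condExp.congr hXY
  refine ⟨hX.sub hY, ?_⟩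
  rw [integral_sub hX hY, ← integral_congr_ae hXY, integral_condExp hm, sub_self]

lemma integral_le_of_condExp_le {m : MeasurableSpace Ω} (hm : m ≤ m0) {X : Ω → ℝ} {C : ℝ}
    (hX : ∀ᵐ ω ∂μ, (μ[X|m]) ω ≤ C) : ∫ ω, X ω ∂μ ≤ C := by
  rw [← integral_condExp hm]
  calc _ ≤ ∫ _, C ∂μ := integral_mono_ae integrable_condExp (integrable_const C) hX
    _ = C := by simp

end Oracle

theorem stmt13 {n : ℕ} {Ω : Type*} {m0 : MeasurableSpace Ω} {μ : Measure Ω}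
    [IsProbabilityMeasure μ] (ℱ : Filtration ℕ m0)
    (S : Set (EuclideanSpace ℝ (Fin n))) (hSne : S.Nonempty) (hSclosed : IsClosed S)
    (r : EuclideanSpace ℝ (Fin n) → ℝ) (hrconv : ConvexOn ℝ S r)
    (Lr : ℝ) (hLr : 0 ≤ Lr)
    (hrlip : ∀ z ∈ S, ∀ w ∈ S, |r z - r w| ≤ Lr * ‖z - w‖)
    (prox : ℝ → EuclideanSpace ℝ (Fin n) → EuclideanSpace ℝ (Fin n))
    (hprox_mem : ∀ t : ℝ, 0 < t → ∀ z, prox t z ∈ S)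
    (hprox_min : ∀ t : ℝ, 0 < t → ∀ z, ∀ y ∈ S,
      r (prox t z) + ‖prox t z - z‖ ^ 2 / (2 * t) ≤ r y + ‖y - z‖ ^ 2 / (2 * t))
    (hprox_uniq : ∀ t : ℝ, 0 < t → ∀ z, ∀ y ∈ S,
      (∀ y' ∈ S, r y + ‖y - z‖ ^ 2 / (2 * t) ≤ r y' + ‖y' - z‖ ^ 2 / (2 * t)) → y = prox t z)
    (f : EuclideanSpace ℝ (Fin n) → ℝ) (g : EuclideanSpace ℝ (Fin n) → EuclideanSpace ℝ (Fin n))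
    (U : Set (EuclideanSpace ℝ (Fin n))) (hU : IsOpen U) (hSU : S ⊆ U)
    (hf : ∀ z ∈ U, HasGradientAt f (g z) z)
    (L : ℝ) (hL : 0 < L)
    (hglip : ∀ z ∈ S, ∀ w ∈ S, ‖g z - g w‖ ≤ L * ‖z - w‖)
    (Bg : ℝ) (hBg : ∀ z ∈ S, ‖g z‖ ≤ Bg)
    (φinf : ℝ) (hφinf : ∀ z ∈ S, φinf ≤ f z + r z)
    (α β s : ℝ) (hα : α ∈ Set.Ioo (0:ℝ) 1) (hβ : β ∈ Set.Ioo (0:ℝ) 1) (hs : 0 < s)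
    (c : ℝ) (hc : c = min s (2 * (1 - α) * β / L))
    (σ : ℝ) (hσ : 0 < σ)
    (N : ℕ → ℕ) (hN : ∀ k, 0 < N k)
    (x : ℕ → Ω → EuclideanSpace ℝ (Fin n)) (t : ℕ → Ω → ℝ)
    (x₀ : EuclideanSpace ℝ (Fin n)) (hx₀ : x₀ ∈ S) (hx₀det : ∀ ω, x 0 ω = x₀)
    (hxmeas : ∀ k, StronglyMeasurable[ℱ k] (x k))
    (htmeas : ∀ k, StronglyMeasurable[ℱ (k + 1)] (t k))
    (htbd : ∀ k, ∀ᵐ ω ∂μ, c ≤ t k ω ∧ t k ω ≤ s)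
    (F : ℕ → Ω → EuclideanSpace ℝ (Fin n) → ℝ) (GF : ℕ → Ω → EuclideanSpace ℝ (Fin n) → EuclideanSpace ℝ (Fin n))
    (hFgrad : ∀ k, ∀ᵐ ω ∂μ, (∀ z ∈ U, HasGradientAt (F k ω) (GF k ω z) z) ∧
      ∀ z ∈ S, ∀ w ∈ S, ‖GF k ω z - GF k ω w‖ ≤ L * ‖z - w‖)
    (horacle_f : ∀ k, ∀ y : Ω → EuclideanSpace ℝ (Fin n),
      StronglyMeasurable[ℱ k] y → (∀ ω, y ω ∈ S) →
      Integrable (fun ω => F k ω (y ω)) μ ∧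
        μ[(fun ω => F k ω (y ω))|ℱ k] =ᵐ[μ] fun ω => f (y ω))
    (horacle_g : ∀ k, ∀ y : Ω → EuclideanSpace ℝ (Fin n),
      StronglyMeasurable[ℱ k] y → (∀ ω, y ω ∈ S) →
      Integrable (fun ω => GF k ω (y ω)) μ ∧
        μ[(fun ω => GF k ω (y ω))|ℱ k] =ᵐ[μ] fun ω => g (y ω))
    (horacle_var : ∀ k, ∀ y : Ω → EuclideanSpace ℝ (Fin n),
      StronglyMeasurable[ℱ k] y → (∀ ω, y ω ∈ S) →
      Integrable (fun ω => ‖GF k ω (y ω) - g (y ω)‖ ^ 2) μ ∧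
        ∀ᵐ ω ∂μ, (μ[(fun ω' => ‖GF k ω' (y ω') - g (y ω')‖ ^ 2)|ℱ k]) ω ≤ σ ^ 2 / N k)
    (hupdate : ∀ k, ∀ᵐ ω ∂μ,
      x (k + 1) ω = prox (t k ω) (x k ω - t k ω • GF k ω (x k ω)))
    (K : ℕ) (hK : 1 ≤ K)
    (cb cp : ℝ) (hcb : 0 < cb) (hcp : cp ∈ Set.Ioc (0:ℝ) 1)
    (hNdef : ∀ k, k < K → N k = ⌈cb * K⌉₊)
    (harmijo : ∀ k, k < K → ∀ᵐ ω ∂μ, F k ω (x (k + 1) ω) + r (x (k + 1) ω)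
        ≤ F k ω (x k ω) + r (x k ω) - (α / t k ω) * ‖x k ω - x (k + 1) ω‖ ^ 2)
    (hφint : ∀ k, k ≤ K → Integrable (fun ω => f (x k ω) + r (x k ω)) μ)
    (hGint : ∀ k, k < K → Integrable (fun ω => ‖(1 / s) • (x k ω - prox s (x k ω - s • g (x k ω)))‖ ^ 2) μ)
    (hFint : ∀ k, k < K → Integrable (fun ω => F k ω (x (k + 1) ω) + r (x (k + 1) ω)) μ)
    (hchange : ∀ᵐ ω ∂μ,
      (((Finset.range K).filter (fun i => t i ω ≠ if i = 0 then s else t (i - 1) ω)).card : ℝ) ≤ (1 / cp + 1) * ((⌈max (Real.logb (1 / β) (s * L / (2 * (1 - α)))) 0 + 2⌉ : ℤ) : ℝ)) :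
    (1 / K) * ∑ k ∈ Finset.range K, ∫ ω, ‖(1 / s) • (x k ω - prox s (x k ω - s • g (x k ω)))‖ ^ 2 ∂μ
      ≤ 2 * (f x₀ + r x₀ - φinf) / (α * c * K)
        + (1 / L + 6 * L * s ^ 2 + 2 * α * c) * σ ^ 2 / (α * c * cb * K)
        + 6 * L * (s - c) ^ 2 * (Lr + 3 * Bg) ^ 2 * ((⌈max (Real.logb (1 / β) (s * L / (2 * (1 - α)))) 0 + 2⌉ : ℤ) : ℝ) * (cp + 1)
          / (α * c * cp * K) := by
  obtain ⟨hα0, hα1⟩ := hα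
  obtain ⟨hβ0, hβ1⟩ := hβ
  have hc0 : 0 < c := by
    rw [hc]
    exact lt_min hs (div_pos (mul_pos (mul_pos two_pos (sub_pos.2 hα1)) hβ0) hL)
  have hcs : c ≤ s := hc ▸ min_le_left _ _
  have hprox : ∀ t : ℝ, 0 < t → ∀ z, IsProxPoint S r t z (prox t z) := fun t ht z =>
    isProxPoint_of_isMin hrconv ht (hprox_mem t ht z) (hprox_min t ht z)
  have hKpos : (0 : ℝ) < K := by exact_mod_cast hK
  have hxS : ∀ k, ∀ᵐ ω ∂μ, x k ω ∈ S := by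
    rintro (_ | k)
    · exact ae_of_all _ fun ω => by rw [hx₀det]; exact hx₀
    · filter_upwards [hupdate k, htbd k] with ω h1 h2
      rw [h1]
      exact hprox_mem _ (hc0.trans_le h2.1) _
  let tp : ℕ → Ω → ℝ := fun k ω => if k = 0 then s else t (k - 1) ω
  have htp_meas : ∀ k, Measurable[ℱ k] (tp k) := by
    rintro (_ | k)
    · exact measurable_const
    · exact (htmeas k).measurable
  have htp_mem : ∀ k, ∀ᵐ ω ∂μ, tp k ω ∈ Set.Icc c s := by
    rintro (_ | k)
    · exact ae_of_all _ fun ω => ⟨hcs, le_rfl⟩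
    · exact htbd k
  let xS : ℕ → Ω → S := fun k ω =>
    open Classical in if h : x k ω ∈ S then ⟨x k ω, h⟩ else ⟨x₀, hx₀⟩
  have hxS_eq : ∀ k ω, x k ω ∈ S → (xS k ω : EuclideanSpace ℝ (Fin n)) = x k ω :=
    fun k ω h => by simp [xS, h]
  have hxS_meas : ∀ k, Measurable[ℱ k] (xS k) := fun k => by
    classical
    have h : Measurable[ℱ k] fun ω => (xS k ω : EuclideanSpace ℝ (Fin n)) := by
      have e : (fun ω => (xS k ω : EuclideanSpace ℝ (Fin n)))
          = fun ω => if x k ω ∈ S then x k ω else x₀ := by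
        funext ω
        by_cases h : x k ω ∈ S <;> simp [xS, h]
      rw [e]
      exact Measurable.ite ((hxmeas k).measurable hSclosed.measurableSet)
        (hxmeas k).measurable measurable_const
    exact Measurable.subtype_mk h
  let y : ℕ → Ω → EuclideanSpace ℝ (Fin n) := fun k ω =>
    prox (max c (tp k ω)) ((xS k ω : EuclideanSpace ℝ (Fin n)) - max c (tp k ω) • g (xS k ω))
  have hmax : ∀ k ω, 0 < max c (tp k ω) := fun k ω => hc0.trans_le (le_max_left _ _)
  have hyS : ∀ k ω, y k ω ∈ S := fun k ω => hprox_mem _ (hmax k ω) _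
  have hy_meas : ∀ k, StronglyMeasurable[ℱ k] (y k) := fun k => by
    have h1 : Measurable[ℱ k] fun ω => (⟨max c (tp k ω), hmax k ω⟩ : Set.Ioi (0 : ℝ)) :=
      Measurable.subtype_mk (measurable_const.max (htp_meas k))
    exact ((continuous_prox_step hprox hglip).measurable.comp
      (h1.prodMk (hxS_meas k))).stronglyMeasurable
  have hz_meas : ∀ k, StronglyMeasurable[ℱ k]
      fun ω => (xS k ω : EuclideanSpace ℝ (Fin n)) := fun k =>
    (measurable_subtype_coe.comp (hxS_meas k)).stronglyMeasurable
  have hzS : ∀ k ω, (xS k ω : EuclideanSpace ℝ (Fin n)) ∈ S := fun k ω => (xS k ω).2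
  let ind : ℕ → Ω → ℝ := fun k ω => if t k ω = tp k ω then 0 else 1
  have hind_int : ∀ k, Integrable (ind k) μ := fun k => by
    have h1 : Measurable (t k) := (htmeas k).measurable.mono (ℱ.le _) le_rfl
    have h2 : Measurable (tp k) := (htp_meas k).mono (ℱ.le _) le_rfl
    have hm : Measurable (ind k) :=
      Measurable.ite (measurableSet_eq_fun h1 h2) measurable_const measurable_const
    refine Integrable.of_bound hm.aestronglyMeasurable 1 (ae_of_all _ fun ω => ?_)
    simp only [ind]
    split_ifs <;> simp
  set A : ℝ := 1 / (2 * L) + (3 * L * s ^ 2 + α * c) with hA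
  set B : ℝ := 3 * L * (s - c) ^ 2 * (Lr + 3 * Bg) ^ 2 with hB
  have hB0 : 0 ≤ B := by positivity
  have hA0 : 0 ≤ A := by positivity
  have hstep : ∀ k ∈ Finset.range K,
      α * c / 2 * ∫ ω, ‖(1 / s) • (x k ω - prox s (x k ω - s • g (x k ω)))‖ ^ 2 ∂μ
        ≤ (∫ ω, (f (x k ω) + r (x k ω)) ∂μ - ∫ ω, (f (x (k + 1) ω) + r (x (k + 1) ω)) ∂μ)
          + A * (σ ^ 2 / (cb * K)) + B * ∫ ω, ind k ω ∂μ := by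
    intro k hk
    have hkK : k < K := Finset.mem_range.1 hk
    have hNk : σ ^ 2 / N k ≤ σ ^ 2 / (cb * K) := by
      rw [hNdef k hkK]
      gcongr
      exact Nat.le_ceil _
    obtain ⟨hFx, hFx0⟩ := integral_sub_eq_zero_of_condExp_eq (ℱ.le k)
      (horacle_f k _ (hz_meas k) (hzS k)).1 (horacle_f k _ (hz_meas k) (hzS k)).2
    obtain ⟨hFy, hFy0⟩ := integral_sub_eq_zero_of_condExp_eq (ℱ.le k)
      (horacle_f k _ (hy_meas k) (hyS k)).1 (horacle_f k _ (hy_meas k) (hyS k)).2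
    obtain ⟨hex, hex'⟩ := horacle_var k _ (hz_meas k) (hzS k)
    obtain ⟨hey, hey'⟩ := horacle_var k _ (hy_meas k) (hyS k)
    have hVx := (integral_le_of_condExp_le (ℱ.le k) hex').trans hNk
    have hVy := (integral_le_of_condExp_le (ℱ.le k) hey').trans hNk
    have hpt : ∀ᵐ ω ∂μ,
        α * c / 2 * ‖(1 / s) • (x k ω - prox s (x k ω - s • g (x k ω)))‖ ^ 2
          ≤ (f (x k ω) + r (x k ω)) - (f (x (k + 1) ω) + r (x (k + 1) ω))
            + (F k ω (xS k ω) - f (xS k ω)) - (F k ω (y k ω) - f (y k ω))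
            + 1 / (2 * L) * ‖GF k ω (y k ω) - g (y k ω)‖ ^ 2
            + (3 * L * s ^ 2 + α * c) * ‖GF k ω (xS k ω) - g (xS k ω)‖ ^ 2
            + B * ind k ω := by
      filter_upwards [hxS k, htbd k, htp_mem k, hFgrad k, hupdate k, harmijo k hkK]
        with ω h1 h2 h3 h4 h5 h6
      rw [hxS_eq k ω h1]
      refine armijo_step_bound hrconv hLr hrlip hprox (fun z hz => hf z (hSU hz))
        (fun z hz => h4.1 z (hSU hz)) hL hglip h4.2 hBg hα0 hc0 h2 h3 h1 h5 ?_ h6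
      simp only [y, hxS_eq k ω h1, max_eq_right h3.1]
    have i1 := hφint k hkK.le
    have i2 := hφint (k + 1) hkK
    have j1 := i1.sub i2
    have j2 := j1.add hFx
    have j3 := j2.sub hFy
    have j4 := j3.add (hey.const_mul (1 / (2 * L)))
    have j5 := j4.add (hex.const_mul (3 * L * s ^ 2 + α * c))
    have j6 := j5.add ((hind_int k).const_mul B)
    have hmono := integral_mono_ae ((hGint k hkK).const_mul (α * c / 2)) j6 hpt
    rw [integral_const_mul, integral_add' j5 ((hind_int k).const_mul B),
      integral_add' j4 (hex.const_mul _), integral_add' j3 (hey.const_mul _),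
      integral_sub' j2 hFy, integral_add' j1 hFx, integral_sub' i1 i2, hFx0, hFy0,
      integral_const_mul, integral_const_mul, integral_const_mul] at hmono
    have hV1 := mul_le_mul_of_nonneg_left hVy (by positivity : 0 ≤ 1 / (2 * L))
    have hV2 := mul_le_mul_of_nonneg_left hVx (by positivity : 0 ≤ 3 * L * s ^ 2 + α * c)
    rw [hA]
    linarith
  set M : ℝ := ((⌈max (Real.logb (1 / β) (s * L / (2 * (1 - α)))) 0 + 2⌉ : ℤ) : ℝ) with hM
  have hind_sum : ∑ k ∈ Finset.range K, ∫ ω, ind k ω ∂μ ≤ (1 / cp + 1) * M := by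
    rw [← integral_finsetSum _ fun k _ => hind_int k]
    calc _ ≤ ∫ _, (1 / cp + 1) * M ∂μ := by
          refine integral_mono_ae (integrable_finsetSum _ fun k _ => hind_int k)
            (integrable_const _) ?_
          filter_upwards [hchange] with ω hω
          refine le_trans (le_of_eq ?_) hω
          rw [Finset.card_filter]
          push_cast
          refine Finset.sum_congr rfl fun k _ => ?_
          simp only [ind, tp, ne_eq, ite_not]
      _ = _ := by simp
  have hsum := Finset.sum_le_sum hstep
  rw [← Finset.mul_sum, Finset.sum_add_distrib, Finset.sum_add_distrib,
    Finset.sum_range_sub' (fun k => ∫ ω, (f (x k ω) + r (x k ω)) ∂μ), Finset.sum_const,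
    Finset.card_range, nsmul_eq_mul, ← Finset.mul_sum] at hsum
  have hφ0 : ∫ ω, (f (x 0 ω) + r (x 0 ω)) ∂μ = f x₀ + r x₀ := by simp [hx₀det]
  have hφK : φinf ≤ ∫ ω, (f (x K ω) + r (x K ω)) ∂μ := by
    calc φinf = ∫ _, φinf ∂μ := by simp
      _ ≤ _ := by
        refine integral_mono_ae (integrable_const _) (hφint K le_rfl) ?_
        filter_upwards [hxS K] with ω h
        exact hφinf _ h
  rw [hφ0] at hsum
  have hind_sum' := mul_le_mul_of_nonneg_left hind_sum hB0
  have hcp0 := hcp.1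
  set T := ∑ k ∈ Finset.range K,
    ∫ ω, ‖(1 / s) • (x k ω - prox s (x k ω - s • g (x k ω)))‖ ^ 2 ∂μ
  have hT : α * c / 2 * T
      ≤ f x₀ + r x₀ - φinf + K * (A * (σ ^ 2 / (cb * K))) + B * ((1 / cp + 1) * M) := by
    linarith
  calc 1 / (K : ℝ) * T = 2 / (α * c * K) * (α * c / 2 * T) := by field_simp
    _ ≤ 2 / (α * c * K) * (f x₀ + r x₀ - φinf + K * (A * (σ ^ 2 / (cb * K)))
        + B * ((1 / cp + 1) * M)) := by gcongr
    _ = _ := by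
      rw [hA, hB]
      field_simp
      ring
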